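/- Let k be an odd integer and s ≥ 0 an integer such that k' := k−2s+1 satisfies 2 ≤ k' ≤ 2n (note k' is even), and let m ∈ {1,…,2n} be arbitrary. For each j with 1 ≤ j ≤ k', let (i_1,…,i_{k'}) denote the sequence (1, 2, …, j−1, j+1, …, k', m) and set β_j := [x_{i_1}, x_{i_2}]·[x_{i_3}, x_{i_4}]⋯[x_{i_{k'−1}}, x_{i_{k'}}] ∈ A_{2n}; also set β := [x_1, x_2]·[x_3, x_4]⋯[x_{k'−1}, x_{k'}]. Then the element Σ_{j=1}^{k'} (−1)^j·[x_j, β_j·ω^s] − [ω^s·x_m, β] lies in L_4(A_{2n}). -/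

import Mathlib

noncomputable section

/-- Lower central series: `lcs A 1 = A`, `lcs A (k+1) = [A, lcs A k]` (ℂ-linear span). -/
def lcs (A : Type) [Ring A] [Algebra ℂ A] : ℕ → Submodule ℂ A
  | 0 => ⊤
  | 1 => ⊤
  | (k+2) => Submodule.span ℂ {x | ∃ a : A, ∃ b ∈ lcs A (k+1), x = a * b - b * a}

/-- The free algebra on `2n` generators. -/
abbrev FA (n : ℕ) : Type := FreeAlgebra ℂ (Fin (2*n))

/-- The generator `x_j` (1-based indexing, junk value `0` out of range). -/
def X (n : ℕ) (j : ℕ) : FA n :=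
  if h : 1 ≤ j ∧ j ≤ 2*n then FreeAlgebra.ι ℂ (⟨j-1, by omega⟩ : Fin (2*n)) else 0

/-- `ω = (1/2) ∑ᵢ [xᵢ, xᵢ₊ₙ]`. -/
def omg (n : ℕ) : FA n :=
  (1/2 : ℂ) • ∑ i ∈ Finset.Icc 1 n, (X n i * X n (i+n) - X n (i+n) * X n i)


/-- The commutator `[x_a, x_b]` of two generators. -/
def br (n : ℕ) (a b : ℕ) : FA n := X n a * X n b - X n b * X n a

section LowerCentralSeries

variable {A : Type} [Ring A] [Algebra ℂ A]

theorem commutator_mem_lcs {k : ℕ} (a : A) {b : A} (hb : b ∈ lcs A (k + 1)) :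
    a * b - b * a ∈ lcs A (k + 2) :=
  Submodule.subset_span ⟨a, b, hb, rfl⟩

theorem commutator_mem_lcs_symm {k : ℕ} (a : A) {b : A} (hb : b ∈ lcs A (k + 1)) :
    b * a - a * b ∈ lcs A (k + 2) := by
  simpa using neg_mem (commutator_mem_lcs a hb)

theorem commutator_mem_lcs_two (a b : A) : a * b - b * a ∈ lcs A 2 :=
  commutator_mem_lcs (k := 0) a (b := b) trivial

theorem lcs_succ_le (k : ℕ) : lcs A (k + 2) ≤ lcs A (k + 1) := by
  induction k with
  | zero => exact le_top
  | succ k ih =>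
    refine Submodule.span_mono ?_
    rintro _ ⟨a, b, hb, rfl⟩
    exact ⟨a, b, ih hb, rfl⟩

/-- Commutators of commutators lie in the fourth term of the lower central series. -/
theorem commutator_commutator_mem_lcs_four (a b c d : A) :
    (a * b - b * a) * (c * d - d * c) - (c * d - d * c) * (a * b - b * a) ∈ lcs A 4 := by
  have h : (a * b - b * a) * (c * d - d * c) - (c * d - d * c) * (a * b - b * a) =
      (a * (b * (c * d - d * c) - (c * d - d * c) * b)
        - (b * (c * d - d * c) - (c * d - d * c) * b) * a)
      - (b * (a * (c * d - d * c) - (c * d - d * c) * a)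
        - (a * (c * d - d * c) - (c * d - d * c) * a) * b) := by noncomm_ring
  rw [h]
  exact sub_mem
    (commutator_mem_lcs (k := 2) _ (commutator_mem_lcs (k := 1) _ (commutator_mem_lcs_two c d)))
    (commutator_mem_lcs (k := 2) _ (commutator_mem_lcs (k := 1) _ (commutator_mem_lcs_two c d)))

/-- A function of five variables that is alternating in the first three and in the last two, and
satisfies the Jacobi identity in the last three, vanishes. -/
theorem eq_zero_of_skew_of_jacobi {α V : Type} [AddCommGroup V] [Module ℂ V]
    (h : α → α → α → α → α → V)
    (s₁ : ∀ e d c a b, h e d c a b = -h d e c a b)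
    (s₂ : ∀ e d c a b, h e d c a b = -h e c d a b)
    (s₃ : ∀ e d c a b, h e d c a b = -h e d c b a)
    (jac : ∀ e d c a b, h e d c a b + h e d a b c + h e d b c a = 0)
    (e d c a b : α) : h e d c a b = 0 := by
  have swap (e d c a b : α) : h e d c a b = h e a b d c := by
    have : h e d c a b + h e d c a b = h e a b d c + h e a b d c := by
      have j₁ := jac e d c a b
      have j₂ := jac e c d a b
      have j₃ := jac e a b c d
      have j₄ := jac e b a c d
      clear jac s₁
      grind
    linear_combination (norm := module) (1/2 : ℂ) • this
  have rot (e d c a b : α) : h e d c a b = h c e d a b := by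
    rw [s₂, s₁]; simp
  have h₁ : h e d c a b = h e d a b c := by
    rw [rot e d c, swap c, rot e d a, swap a, ← rot a b c]
  have h₂ : h e d c a b = h e d b c a := by
    rw [rot e d c, swap c, rot e d b, swap b, rot b c a, rot a b c]
  have := jac e d c a b
  rw [← h₁, ← h₂] at this
  linear_combination (norm := module) (1/3 : ℂ) • this

/-- The identity `[M₃, A] ⊆ L₄` on spanning elements of `M₃ = A · L₃`. -/
theorem commutator_mul_triple_mem_lcs_four (e d c a b : A) :
    e * (d * ((a * b - b * a) * c - c * (a * b - b * a)))
      - d * ((a * b - b * a) * c - c * (a * b - b * a)) * e ∈ lcs A 4 := by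
  have two (x y : A) : x * y - y * x ∈ lcs A 2 := commutator_mem_lcs_two x y
  have three (x y z : A) : (x * y - y * x) * z - z * (x * y - y * x) ∈ lcs A 3 :=
    commutator_mem_lcs_symm (k := 1) z (two x y)
  have four (w : A) {l : A} (hl : l ∈ lcs A 3) : w * l - l * w ∈ lcs A 4 :=
    commutator_mem_lcs (k := 2) w hl
  have five (v w : A) {l : A} (hl : l ∈ lcs A 3) :
      v * (w * l - l * w) - (w * l - l * w) * v ∈ lcs A 4 :=
    four v (lcs_succ_le 2 (four w hl))
  rw [← Submodule.Quotient.mk_eq_zero]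
  refine eq_zero_of_skew_of_jacobi (fun e d c a b => (Submodule.Quotient.mk
    (e * (d * ((a * b - b * a) * c - c * (a * b - b * a)))
      - d * ((a * b - b * a) * c - c * (a * b - b * a)) * e) : A ⧸ lcs A 4)) ?_ ?_ ?_ ?_ e d c a b
  · intro e d c a b
    rw [← Submodule.Quotient.mk_neg, Submodule.Quotient.eq]
    convert add_mem (four (e * d) (three a b c)) (five d e (three a b c)) using 1
    noncomm_ring
  · intro e d c a b
    rw [← Submodule.Quotient.mk_neg, Submodule.Quotient.eq]
    convert add_mem (four e (three a b (d * c))) (five e c (three a b d)) using 1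
    noncomm_ring
  · intro e d c a b
    rw [← Submodule.Quotient.mk_neg, Submodule.Quotient.eq]
    convert (lcs A 4).zero_mem using 1
    noncomm_ring
  · intro e d c a b
    rw [← Submodule.Quotient.mk_add, ← Submodule.Quotient.mk_add, Submodule.Quotient.mk_eq_zero]
    convert (lcs A 4).zero_mem using 1
    noncomm_ring

variable (A) in
/-- The two-sided ideal generated by the triple commutators, as the left ideal `A · L₃`. -/
def tripleIdeal : Ideal A :=
  Ideal.span {x | ∃ a b c : A, x = (a * b - b * a) * c - c * (a * b - b * a)}

instance : (tripleIdeal A).IsTwoSided where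
  mul_mem_of_left {x} y hx := by
    induction hx using Submodule.span_induction generalizing y with
    | mem x hx =>
      obtain ⟨a, b, c, rfl⟩ := hx
      have h := sub_mem
        (Ideal.mul_mem_left (tripleIdeal A) y (Ideal.subset_span ⟨a, b, c, rfl⟩))
        (Ideal.subset_span ⟨c, a * b - b * a, y, rfl⟩)
      convert h using 1
      noncomm_ring
    | zero => simp
    | add u v _ _ hu hv => rw [add_mul]; exact add_mem (hu y) (hv y)
    | smul a x _ hx => rw [smul_eq_mul, mul_assoc]; exact Ideal.mul_mem_left _ a (hx y)

theorem commutator_mem_lcs_four_of_mem_tripleIdeal {x : A} (hx : x ∈ tripleIdeal A) (e : A) :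
    e * x - x * e ∈ lcs A 4 := by
  suffices h : ∀ d, e * (d * x) - d * x * e ∈ lcs A 4 by simpa using h 1
  induction hx using Submodule.span_induction with
  | mem x hx =>
    obtain ⟨a, b, c, rfl⟩ := hx
    exact fun d => commutator_mul_triple_mem_lcs_four e d c a b
  | zero => simp
  | add u v _ _ hu hv =>
    intro d
    convert add_mem (hu d) (hv d) using 1
    noncomm_ring
  | smul a x _ hx =>
    intro d
    simpa [mul_assoc] using hx (d * a)

/-- The commutator pairing `A / M₃ × A / M₃ → A / L₄`. -/
def pairing (f g : A ⧸ tripleIdeal A) : A ⧸ lcs A 4 :=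
  Submodule.Quotient.mk (f.out * g.out - g.out * f.out)

@[simp]
theorem pairing_mk (f g : A) :
    pairing (Ideal.Quotient.mk (tripleIdeal A) f) (Ideal.Quotient.mk (tripleIdeal A) g) =
      Submodule.Quotient.mk (f * g - g * f) := by
  set f' := (Ideal.Quotient.mk (tripleIdeal A) f).out with hf
  set g' := (Ideal.Quotient.mk (tripleIdeal A) g).out with hg
  have hf' : f' - f ∈ tripleIdeal A := Ideal.Quotient.eq.1 (Ideal.Quotient.mk_out _)
  have hg' : g' - g ∈ tripleIdeal A := Ideal.Quotient.eq.1 (Ideal.Quotient.mk_out _)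
  refine (Submodule.Quotient.eq _).2 ?_
  convert sub_mem (commutator_mem_lcs_four_of_mem_tripleIdeal hg' f')
    (commutator_mem_lcs_four_of_mem_tripleIdeal hf' g) using 1
  rw [← hf, ← hg]
  noncomm_ring

end LowerCentralSeries

section CommutatorPairing

variable {R V : Type} [Ring R] [AddCommGroup V]

/-- Formal properties of the pairing `(f, g) ↦ [f, g] mod L₄` on `A / M₃`. -/
structure IsCommutatorPairing (E : R → R → V) : Prop where
  add_left : ∀ a b c, E (a + b) c = E a c + E b c
  skew : ∀ a b, E a b = -E b a
  cyclic : ∀ a b c, E (a * b) c + E (b * c) a + E (c * a) b = 0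
  commutator_commutator : ∀ a b c d, E (a * b - b * a) (c * d - d * c) = 0
  commutator_mem_center : ∀ a b : R, a * b - b * a ∈ Subring.center R

/-- The product `f i * f (i + 1) * ⋯ * f (i + l - 1)`. -/
def segmentProd (f : ℕ → R) (i l : ℕ) : R :=
  ((List.range l).map fun p => f (i + p)).prod

@[simp]
theorem segmentProd_zero (f : ℕ → R) (i : ℕ) : segmentProd f i 0 = 1 := by
  simp [segmentProd]

theorem segmentProd_succ (f : ℕ → R) (i l : ℕ) :
    segmentProd f i (l + 1) = segmentProd f i l * f (i + l) := by
  simp [segmentProd, List.range_succ]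

theorem segmentProd_add (f : ℕ → R) (i l l' : ℕ) :
    segmentProd f i (l + l') = segmentProd f i l * segmentProd f (i + l) l' := by
  induction l' with
  | zero => simp
  | succ l' ih => rw [← add_assoc, segmentProd_succ, ih, segmentProd_succ, mul_assoc, add_assoc]

theorem segmentProd_congr {f g : ℕ → R} {i l : ℕ} (h : ∀ p, i ≤ p → p < i + l → f p = g p) :
    segmentProd f i l = segmentProd g i l := by
  refine congrArg List.prod (List.map_congr_left fun p hp => h _ (by omega) ?_)
  have := List.mem_range.1 hp
  omega

theorem map_segmentProd {S : Type} [Ring S] (φ : R →+* S) (f : ℕ → R) (i l : ℕ) :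
    φ (segmentProd f i l) = segmentProd (fun p => φ (f p)) i l := by
  simp [segmentProd, map_list_prod, Function.comp_def]

theorem segmentProd_mem_center {f : ℕ → R} (hf : ∀ p, f p ∈ Subring.center R) (i l : ℕ) :
    segmentProd f i l ∈ Subring.center R := by
  refine Subring.list_prod_mem _ fun x hx => ?_
  obtain ⟨p, -, rfl⟩ := List.mem_map.1 hx
  exact hf _

namespace IsCommutatorPairing

variable {E : R → R → V}

theorem zero_left (hE : IsCommutatorPairing E) (a : R) : E 0 a = 0 := by
  simpa using hE.add_left 0 0 a

theorem sub_left (hE : IsCommutatorPairing E) (a b c : R) : E (a - b) c = E a c - E b c := by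
  rw [eq_sub_iff_add_eq, ← hE.add_left, sub_add_cancel]

theorem sub_right (hE : IsCommutatorPairing E) (a b c : R) : E a (b - c) = E a b - E a c := by
  rw [hE.skew, hE.sub_left, hE.skew b, hE.skew c]
  abel

theorem jacobi (hE : IsCommutatorPairing E) (a b c : R) :
    E a (b * c - c * b) + E b (c * a - a * c) + E c (a * b - b * a) = 0 := by
  have h₁ := hE.cyclic a b c
  have h₂ := hE.cyclic b a c
  rw [hE.skew a, hE.skew b, hE.skew c]
  simp only [hE.sub_left]
  rw [← neg_eq_zero, ← sub_zero (0 : V)]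
  nth_rw 1 [← h₁]
  rw [← h₂]
  abel

theorem jacobi_mul_center (hE : IsCommutatorPairing E)
    {k : R} (hk : k ∈ Subring.center R) (a b c : R) :
    -E a ((b * c - c * b) * k) + E b ((a * c - c * a) * k) = E (c * k) (a * b - b * a) := by
  have hk' := Subring.mem_center_iff.1 hk
  have h₁ : (b * c - c * b) * k = b * (c * k) - c * k * b := by
    rw [sub_mul, mul_assoc, mul_assoc, mul_assoc c k b, hk' b]
  have h₂ : (a * c - c * a) * k = 0 - (c * k * a - a * (c * k)) := by
    rw [sub_mul, mul_assoc, mul_assoc, mul_assoc c k a, hk' a]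
    abel
  have h₃ : E b 0 = 0 := by rw [hE.skew, hE.zero_left, neg_zero]
  have h := hE.jacobi a b (c * k)
  rw [h₁, h₂, hE.sub_right b, h₃, zero_sub, ← neg_add, neg_eq_iff_add_eq_zero]
  exact h

theorem shift_mul_center (hE : IsCommutatorPairing E)
    {k : R} (hk : k ∈ Subring.center R) (x y z a b : R) :
    E (x * (y * z - z * y) * k) (a * b - b * a) = E ((x * y - y * x) * z * k) (a * b - b * a) := by
  have hk' := Subring.mem_center_iff.1 hk
  rw [← sub_eq_zero, ← hE.sub_left, ← hE.commutator_commutator (y * k) (x * z) a b]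
  congr 1
  rw [mul_assoc y k, ← hk' (x * z)]
  noncomm_ring

theorem shift_segmentProd (hE : IsCommutatorPairing E)
    (y : ℕ → R) (i l : ℕ) {k : R} (hk : k ∈ Subring.center R) (a b : R) :
    E (y (2 * i) * segmentProd (fun p => y (2 * p + 1) * y (2 * p + 2)
        - y (2 * p + 2) * y (2 * p + 1)) i l * k) (a * b - b * a) =
      E (segmentProd (fun p => y (2 * p) * y (2 * p + 1) - y (2 * p + 1) * y (2 * p)) i l
        * y (2 * (i + l)) * k) (a * b - b * a) := by
  induction l generalizing k with
  | zero => simp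
  | succ l ih =>
    rw [segmentProd_succ, segmentProd_succ]
    set c := segmentProd (fun p => y (2 * p) * y (2 * p + 1) - y (2 * p + 1) * y (2 * p)) i l
    have hc : c ∈ Subring.center R :=
      segmentProd_mem_center (fun p => hE.commutator_mem_center _ _) i l
    have hc' := Subring.mem_center_iff.1 hc
    have hcl (x z : R) : x * (c * z) = c * (x * z) := by
      rw [← mul_assoc, hc', mul_assoc]
    have h := hE.shift_mul_center (mul_mem hc hk) (y (2 * (i + l))) (y (2 * (i + l) + 1))
      (y (2 * (i + l) + 2)) a b
    have h' := ih (mul_mem (hE.commutator_mem_center (y (2 * (i + l) + 1)) (y (2 * (i + l) + 2))) hk)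
    simp only [mul_assoc, hcl] at h h' ⊢
    exact h'.trans h

theorem one_right (hE : IsCommutatorPairing E) (a : R) : E a 1 = 0 := by
  have h := hE.cyclic a 1 1
  rw [mul_one, mul_one, one_mul, hE.skew 1 a] at h
  simpa using h

theorem segmentProd_right (hE : IsCommutatorPairing E)
    (c : ℕ → R) (hc : ∀ p, c p ∈ Subring.center R) (r : ℕ) (y : R) :
    E y (segmentProd c 0 r) = ∑ i ∈ Finset.range r,
      E (y * segmentProd c 0 i * segmentProd c (i + 1) (r - 1 - i)) (c i) := by
  induction r generalizing y with
  | zero => simpa using hE.one_right y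
  | succ r ih =>
    have hl (x : R) : x * c r = c r * x := Subring.mem_center_iff.1 (hc r) x
    have h := hE.cyclic y (segmentProd c 0 r) (c r)
    rw [hE.skew (_ * c r) y, ih] at h
    have h' : E y (segmentProd c 0 r * c r) = E (y * segmentProd c 0 r) (c r) +
        ∑ i ∈ Finset.range r,
          E (c r * y * segmentProd c 0 i * segmentProd c (i + 1) (r - 1 - i)) (c i) := by
      rw [← sub_eq_zero, ← neg_eq_zero, ← h]
      abel
    rw [segmentProd_succ, zero_add, h', Finset.sum_range_succ, add_comm]
    congr 1
    · refine Finset.sum_congr rfl fun i hi => ?_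
      have hi := Finset.mem_range.1 hi
      rw [show r + 1 - 1 - i = r - 1 - i + 1 by omega, segmentProd_succ,
        show i + 1 + (r - 1 - i) = r by omega, ← mul_assoc _ _ (c r), hl]
      simp only [mul_assoc]
    · simp

theorem alternating_sum (hE : IsCommutatorPairing E)
    (y : ℕ → R) {u : R} (hu : u ∈ Subring.center R) (r : ℕ) :
    ∑ i ∈ Finset.range r,
      (-E (y (2 * i)) (segmentProd (fun p => y (2 * p) * y (2 * p + 1) - y (2 * p + 1) * y (2 * p)) 0 i
          * (y (2 * i + 1) * y (2 * i + 2) - y (2 * i + 2) * y (2 * i + 1))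
          * segmentProd (fun p => y (2 * p + 1) * y (2 * p + 2) - y (2 * p + 2) * y (2 * p + 1))
            (i + 1) (r - 1 - i) * u)
        + E (y (2 * i + 1)) (segmentProd (fun p => y (2 * p) * y (2 * p + 1)
            - y (2 * p + 1) * y (2 * p)) 0 i
          * (y (2 * i) * y (2 * i + 2) - y (2 * i + 2) * y (2 * i))
          * segmentProd (fun p => y (2 * p + 1) * y (2 * p + 2) - y (2 * p + 2) * y (2 * p + 1))
            (i + 1) (r - 1 - i) * u)) =
      E (u * y (2 * r))
        (segmentProd (fun p => y (2 * p) * y (2 * p + 1) - y (2 * p + 1) * y (2 * p)) 0 r) := by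
  rw [hE.segmentProd_right _ (fun p => hE.commutator_mem_center _ _)]
  refine Finset.sum_congr rfl fun i hi => ?_
  have hi := Finset.mem_range.1 hi
  have h := hE.shift_segmentProd y (i + 1) (r - 1 - i) (mul_mem (segmentProd_mem_center
    (fun p => hE.commutator_mem_center (y (2 * p)) (y (2 * p + 1))) 0 i) hu) (y (2 * i))
    (y (2 * i + 1))
  rw [show i + 1 + (r - 1 - i) = r by omega] at h
  set c := segmentProd (fun p => y (2 * p) * y (2 * p + 1) - y (2 * p + 1) * y (2 * p)) 0 i
  set c' := segmentProd (fun p => y (2 * p) * y (2 * p + 1) - y (2 * p + 1) * y (2 * p))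
    (i + 1) (r - 1 - i)
  set w := segmentProd (fun p => y (2 * p + 1) * y (2 * p + 2) - y (2 * p + 2) * y (2 * p + 1))
    (i + 1) (r - 1 - i)
  have hc : c ∈ Subring.center R :=
    segmentProd_mem_center (fun p => hE.commutator_mem_center _ _) 0 i
  have hc' : c' ∈ Subring.center R :=
    segmentProd_mem_center (fun p => hE.commutator_mem_center _ _) _ _
  have hw : w ∈ Subring.center R :=
    segmentProd_mem_center (fun p => hE.commutator_mem_center _ _) _ _
  have comm {z : R} (hz : z ∈ Subring.center R) (x : R) : x * z = z * x :=
    Subring.mem_center_iff.1 hz x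
  have h' := hE.jacobi_mul_center (mul_mem hw (mul_mem hc hu)) (y (2 * i)) (y (2 * i + 1))
    (y (2 * i + 2))
  have e₁ (x : R) : c * x * w * u = x * (w * (c * u)) := by
    rw [← comm hc x, mul_assoc x c w, ← comm hc w]
    simp only [mul_assoc]
  have e₂ : u * y (2 * r) * c * c' = c' * y (2 * r) * (c * u) := by
    rw [comm hc', ← comm hu]
    simp only [mul_assoc]
    rw [comm hc u]
  rw [e₁, e₁, h', e₂, ← h, ← mul_assoc (y _) w]
  rfl

end IsCommutatorPairing

end CommutatorPairing

theorem prod_map_range_eq_segmentProd {R : Type} [Ring R] (f : ℕ → R) (r : ℕ) :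
    ((List.range r).map f).prod = segmentProd f 0 r := by
  simp [segmentProd]

theorem segmentProd_eq_mul_mul {R : Type} [Ring R] (f : ℕ → R) {i r : ℕ} (hi : i < r) :
    segmentProd f 0 r = segmentProd f 0 i * f i * segmentProd f (i + 1) (r - 1 - i) := by
  conv_lhs => rw [show r = i + 1 + (r - 1 - i) by omega, segmentProd_add, segmentProd_succ]
  simp

theorem isCommutatorPairing_pairing (A : Type) [Ring A] [Algebra ℂ A] :
    IsCommutatorPairing (pairing (A := A)) := by
  have hs := Ideal.Quotient.mk_surjective (I := tripleIdeal A)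
  refine ⟨hs.forall₃.2 fun a b c => ?_, hs.forall₂.2 fun a b => ?_, hs.forall₃.2 fun a b c => ?_,
    hs.forall₂.2 fun a b => hs.forall₂.2 fun c d => ?_, hs.forall₂.2 fun a b => ?_⟩
  · rw [← map_add, pairing_mk, pairing_mk, pairing_mk, ← Submodule.Quotient.mk_add]
    congr 1
    noncomm_ring
  · rw [pairing_mk, pairing_mk, ← Submodule.Quotient.mk_neg]
    congr 1
    noncomm_ring
  · simp only [← map_mul, pairing_mk, ← Submodule.Quotient.mk_add]
    rw [Submodule.Quotient.mk_eq_zero]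
    convert (lcs A 4).zero_mem using 1
    noncomm_ring
  · simp only [← map_mul, ← map_sub, pairing_mk]
    exact (Submodule.Quotient.mk_eq_zero _).2 (commutator_commutator_mem_lcs_four a b c d)
  · refine Subring.mem_center_iff.2 (hs.forall.2 fun c => ?_)
    simp only [← map_mul, ← map_sub]
    rw [eq_comm, Ideal.Quotient.eq]
    exact Ideal.subset_span ⟨a, b, c, rfl⟩

theorem mk_omg_mem_center (n : ℕ) :
    Ideal.Quotient.mk (tripleIdeal (FA n)) (omg n) ∈ Subring.center _ := by
  rw [omg, Algebra.smul_def, map_mul, map_sum]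
  refine mul_mem ?_ (sum_mem fun i _ => ?_)
  · refine Subring.mem_center_iff.2 (Ideal.Quotient.mk_surjective.forall.2 fun c => ?_)
    rw [← map_mul, ← map_mul, Algebra.commutes]
  · rw [map_sub, map_mul, map_mul]
    exact (isCommutatorPairing_pairing (FA n)).commutator_mem_center _ _

theorem sum_Icc_one_two_mul {V : Type} [AddCommMonoid V] (g : ℕ → V) (r : ℕ) :
    ∑ j ∈ Finset.Icc 1 (2 * r), g j = ∑ i ∈ Finset.range r, (g (2 * i + 1) + g (2 * i + 2)) := by
  induction r with
  | zero => simp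
  | succ r ih =>
    rw [show 2 * (r + 1) = 2 * r + 1 + 1 by ring, Finset.sum_Icc_succ_top (by omega),
      Finset.sum_Icc_succ_top (by omega), ih, Finset.sum_range_succ, add_assoc]

/-- For `k` odd, `s ≥ 0` with `k' := k−2s+1` satisfying `2 ≤ k' ≤ 2n`, and any
`m ∈ {1,…,2n}`: with `(i_1,…,i_{k'}) := (1,…,j−1,j+1,…,k',m)`,
`β_j := [x_{i_1},x_{i_2}]⋯[x_{i_{k'−1}},x_{i_{k'}}]` and
`β := [x_1,x_2]⋯[x_{k'−1},x_{k'}]`, the element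
`∑_{j=1}^{k'} (−1)^j [x_j, β_j·ω^s] − [ω^s·x_m, β]` lies in `L₄(A_{2n})`. -/
theorem stmt7 (n : ℕ) (hn : 1 ≤ n) (k s : ℕ) (hodd : Odd k) (hsk : 2*s ≤ k - 1)
    (k' : ℕ) (hk' : k' = k - 2*s + 1) (hk'1 : 2 ≤ k') (hk'2 : k' ≤ 2*n)
    (m : ℕ) (hm1 : 1 ≤ m) (hm2 : m ≤ 2*n)
    (idx : ℕ → ℕ → ℕ)
    (hidx : ∀ j r, idx j r = if r ≤ j - 1 then r else if r ≤ k' - 1 then r + 1 else m)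
    (β : ℕ → FA n)
    (hβ : ∀ j, β j =
      ((List.range (k'/2)).map (fun p => br n (idx j (2*p+1)) (idx j (2*p+2)))).prod)
    (β₀ : FA n)
    (hβ₀ : β₀ = ((List.range (k'/2)).map (fun p => br n (2*p+1) (2*p+2))).prod) :
    (∑ j ∈ Finset.Icc 1 k', ((-1 : ℂ))^j •
        (X n j * (β j * (omg n)^s) - (β j * (omg n)^s) * X n j))
      - (((omg n)^s * X n m) * β₀ - β₀ * ((omg n)^s * X n m))
    ∈ lcs (FA n) 4 := by

  obtain ⟨r, rfl⟩ : ∃ r, k' = 2 * r := by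
    obtain ⟨t, rfl⟩ := hodd
    exact ⟨t - s + 1, by omega⟩
  have hr : 2 * r / 2 = r := by omega
  rw [hr] at hβ hβ₀
  set π := Ideal.Quotient.mk (tripleIdeal (FA n))
  have hE := isCommutatorPairing_pairing (FA n)
  let Y (t : ℕ) : FA n := if t < 2 * r then X n (t + 1) else X n m
  have hY {t : ℕ} (ht : t < 2 * r) : Y t = X n (t + 1) := if_pos ht
  have hYm : Y (2 * r) = X n m := if_neg (lt_irrefl _)
  have hYX (j t : ℕ) (h : j = if t < 2 * r then t + 1 else m) : X n j = Y t := by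
    subst h
    by_cases ht : t < 2 * r <;> simp [Y, ht]
  have hbr (a b t t' : ℕ) (ha : a = if t < 2 * r then t + 1 else m)
      (hb : b = if t' < 2 * r then t' + 1 else m) :
      π (br n a b) = π (Y t) * π (Y t') - π (Y t') * π (Y t) := by
    rw [br, hYX a t ha, hYX b t' hb, map_sub, map_mul, map_mul]
  have hu : π (omg n ^ s) ∈ Subring.center _ := by
    rw [map_pow]
    exact pow_mem (mk_omg_mem_center n) s
  have key := hE.alternating_sum (fun t => π (Y t)) hu r
  have h₀ : π β₀ = segmentProd (fun p => π (Y (2 * p)) * π (Y (2 * p + 1))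
      - π (Y (2 * p + 1)) * π (Y (2 * p))) 0 r := by
    rw [hβ₀, prod_map_range_eq_segmentProd, map_segmentProd]
    refine segmentProd_congr fun p _ hp => hbr _ _ _ _ ?_ ?_ <;> rw [if_pos (by omega)]
  have h₁ (i : ℕ) (hi : i < r) : π (β (2 * i + 1)) =
      segmentProd (fun p => π (Y (2 * p)) * π (Y (2 * p + 1))
        - π (Y (2 * p + 1)) * π (Y (2 * p))) 0 i
      * (π (Y (2 * i + 1)) * π (Y (2 * i + 2)) - π (Y (2 * i + 2)) * π (Y (2 * i + 1)))
      * segmentProd (fun p => π (Y (2 * p + 1)) * π (Y (2 * p + 2))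
        - π (Y (2 * p + 2)) * π (Y (2 * p + 1))) (i + 1) (r - 1 - i) := by
    rw [hβ, prod_map_range_eq_segmentProd, map_segmentProd, segmentProd_eq_mul_mul _ hi]
    congr 1
    · congr 1
      · refine segmentProd_congr fun p _ hp => hbr _ _ _ _ ?_ ?_ <;> rw [hidx] <;>
          split_ifs <;> omega
      · apply hbr <;> rw [hidx] <;> split_ifs <;> omega
    · refine segmentProd_congr fun p _ hp => hbr _ _ _ _ ?_ ?_ <;> rw [hidx] <;>
        split_ifs <;> omega
  have h₂ (i : ℕ) (hi : i < r) : π (β (2 * i + 2)) =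
      segmentProd (fun p => π (Y (2 * p)) * π (Y (2 * p + 1))
        - π (Y (2 * p + 1)) * π (Y (2 * p))) 0 i
      * (π (Y (2 * i)) * π (Y (2 * i + 2)) - π (Y (2 * i + 2)) * π (Y (2 * i)))
      * segmentProd (fun p => π (Y (2 * p + 1)) * π (Y (2 * p + 2))
        - π (Y (2 * p + 2)) * π (Y (2 * p + 1))) (i + 1) (r - 1 - i) := by
    rw [hβ, prod_map_range_eq_segmentProd, map_segmentProd, segmentProd_eq_mul_mul _ hi]
    congr 1
    · congr 1
      · refine segmentProd_congr fun p _ hp => hbr _ _ _ _ ?_ ?_ <;> rw [hidx] <;>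
          split_ifs <;> omega
      · apply hbr <;> rw [hidx] <;> split_ifs <;> omega
    · refine segmentProd_congr fun p _ hp => hbr _ _ _ _ ?_ ?_ <;> rw [hidx] <;>
        split_ifs <;> omega
  rw [← h₀, hYm, ← map_mul, pairing_mk] at key
  rw [← Submodule.Quotient.eq, ← key, sum_Icc_one_two_mul, ← Submodule.mkQ_apply, map_sum]
  refine Finset.sum_congr rfl fun i hi => ?_
  have hi := Finset.mem_range.1 hi
  rw [← h₁ i hi, ← h₂ i hi, ← map_mul, ← map_mul, pairing_mk, pairing_mk, hY (by omega),
    hY (by omega), (show Odd (2 * i + 1) from ⟨i, rfl⟩).neg_one_pow,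
    (show Even (2 * i + 2) from ⟨i + 1, by ring⟩).neg_one_pow, neg_one_smul, one_smul, map_add,
    map_neg]
  rfl
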